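/- A conformal Killing field v(x) = X - F·x + λ·x - ⟨Y,x⟩·x + ½⟨x,x⟩·Y on ℝⁿ is everywhere tangent to the circle γ(t) = (2/(1+t²‖C‖²))(tU + t²C) (U unit, ⟨U,C⟩=0) if and only if X = f·U, F·U = -f·C, and Y = h·U + λ·C + F·C, for some scalars f, h. -/

import Mathlib

open Matrix

lemma circ_deriv {n : ℕ} (U C : Fin n → ℝ) (k : ℝ) (hk : 0 ≤ k) (t : ℝ) :
    deriv (fun s : ℝ => (2 / (1 + s ^ 2 * k)) • (s • U + s ^ 2 • C)) t
      = (2 / (1 + t ^ 2 * k) ^ 2) • ((1 - t ^ 2 * k) • U + (2 * t) • C) := by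
  have hD : 1 + t ^ 2 * k ≠ 0 := by positivity
  apply HasDerivAt.deriv
  rw [hasDerivAt_pi]
  intro i
  have h1 : HasDerivAt (fun s : ℝ => 1 + s ^ 2 * k) (2 * t * k) t := by
    simpa using ((hasDerivAt_pow 2 t).mul_const k).const_add 1
  have h2 : HasDerivAt (fun s : ℝ => s * U i + s ^ 2 * C i) (U i + 2 * t * C i) t := by
    have h4 := ((hasDerivAt_id t).mul_const (U i)).add ((hasDerivAt_pow 2 t).mul_const (C i))
    refine h4.congr_deriv ?_
    simp
  have h3 := ((hasDerivAt_const t (2 : ℝ)).div h1 hD).mul h2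
  refine (h3.congr_deriv ?_)
  simp only [Pi.smul_apply, Pi.add_apply, smul_eq_mul]
  simp
  field_simp
  ring

lemma poly_coeffs (a0 a1 a2 a3 a4 a5 a6 : ℝ)
    (h : ∀ t : ℝ, a0 + a1 * t + a2 * t ^ 2 + a3 * t ^ 3 + a4 * t ^ 4 + a5 * t ^ 5
      + a6 * t ^ 6 = 0) : a0 = 0 ∧ a1 = 0 ∧ a2 = 0 := by
  have e0 := h 0
  have e1 := h 1
  have e2 := h (-1)
  have e3 := h 2
  have e4 := h (-2)
  have e5 := h 3
  have e6 := h (-3)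
  norm_num at e0 e1 e2 e3 e4 e5 e6
  refine ⟨?_, ?_, ?_⟩ <;> linarith

/-- explicit form of the field along the circle -/
noncomputable def killP {n : ℕ} (U C X Y G H : Fin n → ℝ) (l k α β t : ℝ) : Fin n → ℝ :=
    (1 / (1 + t ^ 2 * k) ^ 2) •
      (X + t • ((2 * l) • U - (2 : ℝ) • G)
        + t ^ 2 • ((2 * k) • X - (2 : ℝ) • H + (2 * l) • C - (4 * α) • U + (2 : ℝ) • Y)
        + t ^ 3 • ((2 * l * k) • U - (2 * k) • G - (4 * α) • C - (4 * β) • U)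
        + t ^ 4 • ((k ^ 2) • X - (2 * k) • H + (2 * l * k) • C - (4 * β) • C
            + (2 * k) • Y))

/-- the field along the circle, cleared of denominators -/
lemma field_eq {n : ℕ} (U C X Y G H : Fin n → ℝ) (l k α β t : ℝ) (hD : 1 + t ^ 2 * k ≠ 0) :
    X - (2 / (1 + t ^ 2 * k)) • (t • G + t ^ 2 • H)
      + l • ((2 / (1 + t ^ 2 * k)) • (t • U + t ^ 2 • C))
      - ((2 / (1 + t ^ 2 * k)) * (t * α + t ^ 2 * β)) •
          ((2 / (1 + t ^ 2 * k)) • (t • U + t ^ 2 • C))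
      + (2⁻¹ * (4 * t ^ 2 / (1 + t ^ 2 * k))) • Y
    = killP U C X Y G H l k α β t := by
  unfold killP
  ext i
  simp only [Pi.smul_apply, Pi.add_apply, Pi.sub_apply, smul_eq_mul]
  field_simp
  ring

/-- A conformal Killing field `v(x) = X - F·x + λx - ⟨Y,x⟩x + ½⟨x,x⟩Y` is
everywhere tangent to the circle `γ(t) = (2/(1+t²‖C‖²))(tU + t²C)` (with `U`
unit, `⟨U,C⟩ = 0`) iff `X = fU`, `F·U = -fC`, and `Y = hU + λC + F·C`. -/
theorem symmetry_algebra_of_a_circle (n : ℕ) (U C X Y : Fin n → ℝ) (l : ℝ)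
    (F : Matrix (Fin n) (Fin n) ℝ) (hF : Fᵀ = -F) (hU : U ⬝ᵥ U = 1)
    (hUC : U ⬝ᵥ C = 0) :
    (∀ t : ℝ, ∃ c : ℝ,
        (fun x : Fin n → ℝ =>
            X - F.mulVec x + l • x - (Y ⬝ᵥ x) • x + (2⁻¹ * (x ⬝ᵥ x)) • Y)
          ((2 / (1 + t ^ 2 * (C ⬝ᵥ C))) • (t • U + t ^ 2 • C))
          = c • deriv (fun s : ℝ =>
              (2 / (1 + s ^ 2 * (C ⬝ᵥ C))) • (s • U + s ^ 2 • C)) t) ↔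
      ∃ f h : ℝ, X = f • U ∧ F.mulVec U = -(f • C) ∧
        Y = h • U + l • C + F.mulVec C := by
  have hk : 0 ≤ C ⬝ᵥ C := by
    simp only [dotProduct]
    exact Finset.sum_nonneg fun i _ => mul_self_nonneg _
  have hCU : C ⬝ᵥ U = 0 := by rw [dotProduct_comm]; exact hUC
  have hsk : ∀ a b : Fin n → ℝ, (F *ᵥ a) ⬝ᵥ b = -((F *ᵥ b) ⬝ᵥ a) := by
    intro a b
    rw [dotProduct_comm, dotProduct_mulVec, ← mulVec_transpose, hF, neg_mulVec, neg_dotProduct]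
  have hGU : (F *ᵥ U) ⬝ᵥ U = 0 := by linarith [hsk U U]
  have hHC : (F *ᵥ C) ⬝ᵥ C = 0 := by linarith [hsk C C]
  have hHU := hsk C U
  have key : ∀ t : ℝ,
      X - F.mulVec ((2 / (1 + t ^ 2 * (C ⬝ᵥ C))) • (t • U + t ^ 2 • C)) + l • ((2 / (1 + t ^ 2 * (C ⬝ᵥ C))) • (t • U + t ^ 2 • C))
        - (Y ⬝ᵥ ((2 / (1 + t ^ 2 * (C ⬝ᵥ C))) • (t • U + t ^ 2 • C))) • ((2 / (1 + t ^ 2 * (C ⬝ᵥ C))) • (t • U + t ^ 2 • C))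
        + (2⁻¹ * (((2 / (1 + t ^ 2 * (C ⬝ᵥ C))) • (t • U + t ^ 2 • C)) ⬝ᵥ
          ((2 / (1 + t ^ 2 * (C ⬝ᵥ C))) • (t • U + t ^ 2 • C)))) • Y
        = killP U C X Y (F *ᵥ U) (F *ᵥ C) l (C ⬝ᵥ C) (Y ⬝ᵥ U) (Y ⬝ᵥ C) t := fun t => by
    have hD : 1 + t ^ 2 * (C ⬝ᵥ C) ≠ 0 := by positivity
    rw [← field_eq U C X Y (F *ᵥ U) (F *ᵥ C) l (C ⬝ᵥ C) (Y ⬝ᵥ U) (Y ⬝ᵥ C) t hD]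
    have hn : ((2 / (1 + t ^ 2 * (C ⬝ᵥ C))) • (t • U + t ^ 2 • C)) ⬝ᵥ
        ((2 / (1 + t ^ 2 * (C ⬝ᵥ C))) • (t • U + t ^ 2 • C))
        = 4 * t ^ 2 / (1 + t ^ 2 * (C ⬝ᵥ C)) := by
      simp only [smul_dotProduct, dotProduct_smul, add_dotProduct, dotProduct_add, hU, hUC, hCU,
        smul_eq_mul]
      field_simp
      ring
    simp only [hn]
    simp only [mulVec_smul, mulVec_add, dotProduct_smul, dotProduct_add, smul_eq_mul]
  simp only [key, circ_deriv U C _ hk]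
  clear key
  unfold killP
  generalize F *ᵥ U = G at *
  generalize F *ᵥ C = H at *
  generalize hkk : C ⬝ᵥ C = k at *
  constructor
  · intro hyp
    have cof : ∀ i, _ := fun i => poly_coeffs
      (X i - (X ⬝ᵥ U) * U i)
      ((2 * l * U i - 2 * G i) - 2 * l * U i - 2 * (X ⬝ᵥ U) * C i)
      ((2 * k * X i - 2 * H i + 2 * l * C i - 4 * (Y ⬝ᵥ U) * U i + 2 * Y i) - k * X i
        - (2 * k * (X ⬝ᵥ U) - 2 * (H ⬝ᵥ U) - 2 * (Y ⬝ᵥ U) - k * (X ⬝ᵥ U)) * U i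
        - 4 * l * C i)
      ((2 * l * k * U i - 2 * k * G i - 4 * (Y ⬝ᵥ U) * C i - 4 * (Y ⬝ᵥ C) * U i)
        - k * (2 * l * U i - 2 * G i)
        - (2 * l * k - 4 * (Y ⬝ᵥ C) - 2 * l * k) * U i
        - 2 * (2 * k * (X ⬝ᵥ U) - 2 * (H ⬝ᵥ U) - 2 * (Y ⬝ᵥ U)) * C i)
      ((k ^ 2 * X i - 2 * k * H i + 2 * l * k * C i - 4 * (Y ⬝ᵥ C) * C i + 2 * k * Y i)
        - k * (2 * k * X i - 2 * H i + 2 * l * C i - 4 * (Y ⬝ᵥ U) * U i + 2 * Y i)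
        - (k ^ 2 * (X ⬝ᵥ U) - 2 * k * (H ⬝ᵥ U) + 2 * k * (Y ⬝ᵥ U)
          - k * (2 * k * (X ⬝ᵥ U) - 2 * (H ⬝ᵥ U) - 2 * (Y ⬝ᵥ U))) * U i
        - 2 * (2 * l * k - 4 * (Y ⬝ᵥ C)) * C i)
      (- k * (2 * l * k * U i - 2 * k * G i - 4 * (Y ⬝ᵥ U) * C i - 4 * (Y ⬝ᵥ C) * U i)
        + k * (2 * l * k - 4 * (Y ⬝ᵥ C)) * U i
        - 2 * (k ^ 2 * (X ⬝ᵥ U) - 2 * k * (H ⬝ᵥ U) + 2 * k * (Y ⬝ᵥ U)) * C i)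
      (- k * (k ^ 2 * X i - 2 * k * H i + 2 * l * k * C i - 4 * (Y ⬝ᵥ C) * C i + 2 * k * Y i)
        + k * (k ^ 2 * (X ⬝ᵥ U) - 2 * k * (H ⬝ᵥ U) + 2 * k * (Y ⬝ᵥ U)) * U i)
      (by
        intro t
        obtain ⟨c, hc⟩ := hyp t
        have hD : 1 + t ^ 2 * k ≠ 0 := by positivity
        have hi := congrFun hc i
        have hu := congrArg (fun v => v ⬝ᵥ U) hc
        simp only [smul_dotProduct, add_dotProduct, sub_dotProduct, hU, hCU, hGU,
          smul_eq_mul] at hu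
        simp only [Pi.smul_apply, Pi.add_apply, Pi.sub_apply, smul_eq_mul] at hi
        field_simp at hi hu
        linear_combination (1 - t ^ 2 * k) * hi - ((1 - t ^ 2 * k) * U i + 2 * t * C i) * hu)
    have hX : X = (X ⬝ᵥ U) • U := by
      ext i
      simp only [Pi.smul_apply, smul_eq_mul]
      linarith [(cof i).1]
    refine ⟨X ⬝ᵥ U, (k * (X ⬝ᵥ U) - 2 * (H ⬝ᵥ U) - 2 * (Y ⬝ᵥ U) + 4 * (Y ⬝ᵥ U)
      - k * (X ⬝ᵥ U)) / 2, hX, ?_, ?_⟩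
    · ext i
      simp only [Pi.smul_apply, Pi.neg_apply, smul_eq_mul]
      linarith [(cof i).2.1]
    · ext i
      simp only [Pi.smul_apply, Pi.add_apply, smul_eq_mul]
      linear_combination (1/2) * (cof i).2.2 - (k / 2) * (cof i).1
  · rintro ⟨f, h, rfl, rfl, rfl⟩ t
    have hD : 1 + t ^ 2 * k ≠ 0 := by positivity
    simp only [neg_dotProduct, smul_dotProduct, hkk, smul_eq_mul, neg_neg] at hHU
    refine ⟨(f + 2 * l * t - t ^ 2 * (2 * h + f * k)) / 2, ?_⟩
    simp only [smul_dotProduct, add_dotProduct, hU, hCU, hUC, hkk, hHC, hHU, smul_eq_mul]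
    ext i
    simp only [Pi.smul_apply, Pi.add_apply, Pi.sub_apply, Pi.neg_apply, smul_eq_mul]
    field_simp
    ring
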